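/- A graph G is m-sparse if and only if every m-tree-connected component of G is m-sparse (equivalently, is minimally m-tree-connected). -/

import Mathlib

open SimpleGraph

def IsTreeConn {V : Type*} (m : ℕ) (G : SimpleGraph V) : Prop :=
  ∃ T : Fin m → SimpleGraph V, (∀ i, T i ≤ G) ∧ (∀ i, (T i).IsTree) ∧
    ∀ i j, i ≠ j → Disjoint (T i).edgeSet (T j).edgeSet

noncomputable def eIn {V : Type*} (G : SimpleGraph V) (S : Set V) : ℕ :=
  {e ∈ G.edgeSet | ∀ v ∈ e, v ∈ S}.ncard

def IsSparse {V : Type*} (m : ℕ) (G : SimpleGraph V) : Prop :=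
  ∀ S : Set V, S.Nonempty → (eIn G S : ℤ) ≤ m * S.ncard - m

def mComp {V : Type*} (m : ℕ) (G : SimpleGraph V) (v : V) : Set V :=
  ⋃₀ {X : Set V | v ∈ X ∧ IsTreeConn m (G.induce X)}

noncomputable def crossE {V : Type*} (m : ℕ) (G : SimpleGraph V) : ℕ :=
  {e ∈ G.edgeSet | ∃ u ∈ e, ∃ w ∈ e, mComp m G u ≠ mComp m G w}.ncard

noncomputable def Omega {V : Type*} (m : ℕ) (G : SimpleGraph V) : ℤ :=
  m * (Set.range (mComp m G)).ncard - crossE m G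

/-- Colouring form of Rado's theorem on independent transversals: if `#J ≤ ∑ i : ι, r J` for a
monotone submodular `r` and all `J`, then every element can be given at most one colour so that the
ranks of the colour classes still sum up to at least `#J`. -/
theorem exists_coloring_of_card_le_sum_rank {E ι : Type*} [Fintype E] [Fintype ι] [DecidableEq E]
    [DecidableEq ι] (r : Finset E → ℤ) (hmono : Monotone r)
    (hsub : ∀ A B, r (A ∪ B) + r (A ∩ B) ≤ r A + r B)
    (h : ∀ J : Finset E, (J.card : ℤ) ≤ ∑ _i : ι, r J) :
    ∃ L : Finset (E × ι), (∀ e i j, (e, i) ∈ L → (e, j) ∈ L → i = j) ∧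
      ∀ J : Finset E, (J.card : ℤ) ≤ ∑ i, r {e ∈ J | (e, i) ∈ L} := by
  obtain ⟨L, hL⟩ := exists_minimal_of_wellFoundedLT
    (fun L : Finset (E × ι) => ∀ J : Finset E, (J.card : ℤ) ≤ ∑ i, r {e ∈ J | (e, i) ∈ L})
    ⟨Finset.univ, by simpa using h⟩
  refine ⟨L, fun e i j hi hj => ?_, hL.prop⟩
  by_contra hij
  have key : ∀ k, (e, k) ∈ L → ∃ J : Finset E, e ∈ J ∧
      ∑ l, r {x ∈ J | (x, l) ∈ L.erase (e, k)} < J.card := by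
    intro k hk
    have hn := hL.not_prop_of_lt (Finset.erase_ssubset hk)
    push Not at hn
    obtain ⟨J, hJ⟩ := hn
    refine ⟨J, ?_, hJ⟩
    by_contra heJ
    refine (hL.prop J).not_gt (lt_of_eq_of_lt (Finset.sum_congr rfl fun l _ => ?_) hJ)
    congr 1
    ext x
    simp only [Finset.mem_filter, Finset.mem_erase]
    grind
  obtain ⟨A, heA, hA⟩ := key i hi
  obtain ⟨B, heB, hB⟩ := key j hj
  have hle : ∑ l, r {x ∈ A ∪ B | (x, l) ∈ L} + ∑ l, r {x ∈ (A ∩ B).erase e | (x, l) ∈ L} ≤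
      ∑ l, r {x ∈ A | (x, l) ∈ L.erase (e, i)} + ∑ l, r {x ∈ B | (x, l) ∈ L.erase (e, j)} := by
    rw [← Finset.sum_add_distrib, ← Finset.sum_add_distrib]
    refine Finset.sum_le_sum fun l _ => le_trans (add_le_add (hmono ?_) (hmono ?_)) (hsub _ _)
    · intro x
      simp only [Finset.mem_filter, Finset.mem_erase, Finset.mem_union]
      grind
    · intro x
      simp only [Finset.mem_filter, Finset.mem_erase, Finset.mem_inter]
      grind
  have h1 := hL.prop (A ∪ B)
  have h2 := hL.prop ((A ∩ B).erase e)
  have h3 := Finset.card_union_add_card_inter A B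
  have h4 := Finset.card_erase_add_one (Finset.mem_inter.2 ⟨heA, heB⟩)
  omega

namespace SimpleGraph

variable {V : Type*}

/-- The real functions that are constant along the edges of `G`. -/
def edgeConstant (G : SimpleGraph V) : Submodule ℝ (V → ℝ) where
  carrier := {f | ∀ u v, G.Adj u v → f u = f v}
  add_mem' hf hg u v h := by simp [hf u v h, hg u v h]
  zero_mem' _ _ _ := rfl
  smul_mem' c f hf u v h := by simp [hf u v h]

theorem finrank_edgeConstant [Finite V] (G : SimpleGraph V) :
    Module.finrank ℝ G.edgeConstant = Nat.card G.ConnectedComponent := by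
  classical
  have := Fintype.ofFinite V
  rw [Nat.card_eq_fintype_card, card_connectedComponent_eq_finrank_ker_toLin'_lapMatrix]
  congr 2
  all_goals
    ext f
    rw [LinearMap.mem_ker, Matrix.toLin'_apply, lapMatrix_mulVec_eq_zero_iff_forall_adj]
    rfl

theorem edgeConstant_antitone : Antitone (edgeConstant : SimpleGraph V → Submodule ℝ (V → ℝ)) :=
  fun _ _ h _ hf u v huv => hf u v (h huv)

theorem card_connectedComponent_antitone [Finite V] :
    Antitone fun G : SimpleGraph V => Nat.card G.ConnectedComponent := by
  intro G H h
  simp only [← finrank_edgeConstant]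
  exact Submodule.finrank_mono (edgeConstant_antitone h)

theorem card_connectedComponent_add_le [Finite V] (G H : SimpleGraph V) :
    Nat.card G.ConnectedComponent + Nat.card H.ConnectedComponent ≤
      Nat.card (G ⊔ H).ConnectedComponent + Nat.card (G ⊓ H).ConnectedComponent := by
  simp only [← finrank_edgeConstant]
  rw [← Submodule.finrank_sup_add_finrank_inf_eq, add_comm]
  refine add_le_add (Submodule.finrank_mono ?_) (Submodule.finrank_mono ?_)
  · rintro f ⟨hG, hH⟩ u v (h | h)
    exacts [hG u v h, hH u v h]
  · exact sup_le (edgeConstant_antitone inf_le_left) (edgeConstant_antitone inf_le_right)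

theorem connected_of_card_connectedComponent_le_one [Finite V] [Nonempty V] {G : SimpleGraph V}
    (h : Nat.card G.ConnectedComponent ≤ 1) : G.Connected := by
  rw [connected_iff]
  refine ⟨fun u v => ConnectedComponent.exact ?_, inferInstance⟩
  have := Finite.card_le_one_iff_subsingleton.1 h
  exact Subsingleton.elim _ _

end SimpleGraph

section

variable {V : Type*} {m : ℕ} {G H : SimpleGraph V}

theorem eIn_induce (G : SimpleGraph V) (X : Set V) (S : Set X) :
    eIn (G.induce X) S = eIn G (Subtype.val '' S) := by
  unfold eIn
  rw [← Set.ncard_image_of_injective _ (Sym2.map.injective (Subtype.val_injective (p := (· ∈ X))))]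
  congr 1
  ext e
  induction e with | _ a b
  simp only [Set.mem_image, Set.mem_ofPred_eq, Sym2.exists, Sym2.mem_iff, mem_edgeSet, comap_adj,
    Sym2.map_mk]
  constructor
  · rintro ⟨x, y, ⟨h, hS⟩, he⟩
    have hx := hS x (.inl rfl)
    have hy := hS y (.inr rfl)
    rcases Sym2.eq_iff.1 he with ⟨rfl, rfl⟩ | ⟨rfl, rfl⟩
    · refine ⟨h, ?_⟩
      rintro v (rfl | rfl)
      exacts [⟨_, hx, rfl⟩, ⟨_, hy, rfl⟩]
    · refine ⟨h.symm, ?_⟩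
      rintro v (rfl | rfl)
      exacts [⟨_, hy, rfl⟩, ⟨_, hx, rfl⟩]
  · rintro ⟨h, hS⟩
    obtain ⟨x, hx, rfl⟩ := hS a (.inl rfl)
    obtain ⟨y, hy, rfl⟩ := hS b (.inr rfl)
    refine ⟨x, y, ⟨h, ?_⟩, rfl⟩
    rintro v (rfl | rfl)
    exacts [hx, hy]

theorem eIn_univ (G : SimpleGraph V) : eIn G Set.univ = G.edgeSet.ncard := by
  simp [eIn]

theorem IsTreeConn.mono (hH : IsTreeConn m H) (h : H ≤ G) : IsTreeConn m G := by
  obtain ⟨T, hT, hT'⟩ := hH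
  exact ⟨T, fun i => (hT i).trans h, hT'⟩

theorem IsSparse.induce (hG : IsSparse m G) (X : Set V) : IsSparse m (G.induce X) := by
  intro S hS
  rw [eIn_induce, ← Set.ncard_image_of_injective S Subtype.val_injective]
  exact hG _ (hS.image _)

variable [Finite V]

theorem eIn_mono (h : H ≤ G) {S T : Set V} (hST : S ⊆ T) : eIn H S ≤ eIn G T :=
  Set.ncard_le_ncard (fun _ he => ⟨edgeSet_mono h he.1, fun v hv => hST (he.2 v hv)⟩)
    (Set.toFinite _)

theorem IsSparse.mono (hG : IsSparse m G) (h : H ≤ G) : IsSparse m H := fun S hS =>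
  le_trans (by exact_mod_cast eIn_mono h le_rfl) (hG S hS)

theorem ncard_edgeSet_le_sum_eIn_supp (G : SimpleGraph V) [Fintype G.ConnectedComponent] :
    G.edgeSet.ncard ≤ ∑ C : G.ConnectedComponent, eIn G C.supp := by
  refine le_trans (Set.ncard_le_ncard (fun e he => ?_) (Set.toFinite _))
    (Set.ncard_iUnion_le_of_fintype fun C : G.ConnectedComponent =>
      {e ∈ G.edgeSet | ∀ v ∈ e, v ∈ C.supp})
  induction e with | _ a b
  refine Set.mem_iUnion.2 ⟨G.connectedComponentMk a, he, fun v hv => ?_⟩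
  rcases Sym2.mem_iff.1 hv with rfl | rfl
  · rfl
  · exact ConnectedComponent.sound (Adj.reachable he).symm

theorem sum_ncard_supp (G : SimpleGraph V) [Fintype G.ConnectedComponent] :
    ∑ C : G.ConnectedComponent, C.supp.ncard = Nat.card V := by
  classical
  have := Fintype.ofFinite V
  rw [Nat.card_eq_fintype_card, Fintype.card, Finset.card_eq_sum_card_fiberwise
    (f := G.connectedComponentMk) (t := Finset.univ) (fun _ _ => Finset.mem_univ _)]
  refine Finset.sum_congr rfl fun C _ => ?_
  rw [Set.ncard_eq_toFinset_card']
  congr 1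
  ext v
  simp

theorem IsSparse.ncard_edgeSet_le (hG : IsSparse m G) :
    (G.edgeSet.ncard : ℤ) ≤ m * (Nat.card V - Nat.card G.ConnectedComponent) := by
  classical
  have := Fintype.ofFinite G.ConnectedComponent
  calc (G.edgeSet.ncard : ℤ) ≤ ∑ C : G.ConnectedComponent, (eIn G C.supp : ℤ) := by
        exact_mod_cast ncard_edgeSet_le_sum_eIn_supp G
    _ ≤ ∑ C : G.ConnectedComponent, ((m : ℤ) * C.supp.ncard - m) :=
        Finset.sum_le_sum fun C _ => hG _ C.nonempty_supp
    _ = m * (Nat.card V - Nat.card G.ConnectedComponent) := by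
        rw [Finset.sum_sub_distrib, ← Finset.mul_sum, ← Nat.cast_sum, sum_ncard_supp]
        simp
        ring

/-- A tight sparse graph decomposes into `m` spanning trees (Nash-Williams). -/
theorem IsSparse.isTreeConn [Nonempty V] (hG : IsSparse m G)
    (hcard : (m : ℤ) * (Nat.card V - 1) ≤ G.edgeSet.ncard) : IsTreeConn m G := by
  classical
  have := Fintype.ofFinite V
  let F : Finset G.edgeSet → SimpleGraph V := fun J =>
    fromEdgeSet (Subtype.val '' (J : Set G.edgeSet))
  have hF : Monotone F := fun A B h => fromEdgeSet_mono (Set.image_mono (by exact_mod_cast h))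
  have hFedge : ∀ J, (F J).edgeSet = Subtype.val '' (J : Set G.edgeSet) := by
    intro J
    rw [edgeSet_fromEdgeSet, sdiff_eq_left, Set.disjoint_left]
    rintro _ ⟨e, _, rfl⟩
    exact G.not_isDiag_of_mem_edgeSet e.2
  have hFG : ∀ J, F J ≤ G := by
    intro J
    rw [← edgeSet_subset_edgeSet, hFedge]
    rintro _ ⟨e, _, rfl⟩
    exact e.2
  let r : Finset G.edgeSet → ℤ := fun J => Nat.card V - Nat.card (F J).ConnectedComponent
  obtain ⟨L, hL, hr⟩ := exists_coloring_of_card_le_sum_rank (ι := Fin m) r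
    (fun A B h => sub_le_sub_left
      (by exact_mod_cast card_connectedComponent_antitone (hF h)) _)
    (fun A B => by
      have h := card_connectedComponent_add_le (F A) (F B)
      have h1 : F A ⊔ F B = F (A ∪ B) := by
        rw [← edgeSet_inj, edgeSet_sup, hFedge, hFedge, hFedge, Finset.coe_union, Set.image_union]
      have h2 : F A ⊓ F B = F (A ∩ B) := by
        rw [← edgeSet_inj, edgeSet_inf, hFedge, hFedge, hFedge, Finset.coe_inter,
          Set.image_inter Subtype.val_injective]
      rw [h1, h2] at h
      simp only [r]
      omega)
    (fun J => by
      have h := (hG.mono (hFG J)).ncard_edgeSet_le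
      rw [hFedge, Set.ncard_image_of_injective _ Subtype.val_injective, Set.ncard_coe_finset] at h
      simpa [r, mul_sub] using h)
  let C : Fin m → SimpleGraph V := fun i => F {e | (e, i) ∈ L}
  have hpos : ∀ i, 1 ≤ Nat.card (C i).ConnectedComponent := fun i =>
    have : Nonempty (C i).ConnectedComponent := Nonempty.map (C i).connectedComponentMk ‹_›
    Nat.card_pos
  have hconn : ∀ i, (C i).Connected := by
    intro i
    apply connected_of_card_connectedComponent_le_one
    by_contra hi
    have hlt : ∑ i : Fin m, r {e | (e, i) ∈ L} < ∑ i : Fin m, ((Nat.card V : ℤ) - 1) := by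
      refine Finset.sum_lt_sum (fun j _ => ?_) ⟨i, Finset.mem_univ i, ?_⟩
      · exact sub_le_sub_left (by exact_mod_cast hpos j) _
      · exact sub_lt_sub_left (by exact_mod_cast not_le.1 hi) _
    have hu := hr Finset.univ
    rw [Finset.card_univ, ← Nat.card_eq_fintype_card, Nat.card_coe_set_eq] at hu
    rw [Finset.sum_const, Finset.card_univ, Fintype.card_fin, nsmul_eq_mul] at hlt
    exact (hcard.trans hu).not_gt hlt
  choose T hTC hT using fun i => (hconn i).exists_isTree_le
  refine ⟨T, fun i => (hTC i).trans (hFG _), hT, fun i j hij => ?_⟩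
  refine Set.disjoint_of_subset (edgeSet_mono (hTC i)) (edgeSet_mono (hTC j)) ?_
  rw [hFedge, hFedge, Set.disjoint_image_iff Subtype.val_injective, Set.disjoint_left]
  intro e hi hj
  exact hij (hL e i j (by simpa using hi) (by simpa using hj))

/-- A minimal non-sparse vertex set induces an `m`-tree-connected graph. -/
theorem isTreeConn_induce_of_minimal {S : Set V}
    (hS : Minimal (fun S : Set V => S.Nonempty ∧ (m : ℤ) * S.ncard - m < eIn G S) S) :
    IsTreeConn m (G.induce S) := by
  obtain ⟨hne, hlt⟩ := hS.prop
  have := hne.to_subtype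
  have hpos : 1 ≤ S.ncard := (Set.ncard_pos (Set.toFinite _)).2 hne
  have hE : (G.induce S).edgeSet.ncard = eIn G S := by
    rw [← eIn_univ, eIn_induce, Subtype.coe_image_univ]
  have hle : m * (S.ncard - 1) ≤ (G.induce S).edgeSet.ncard := by
    rw [hE]
    zify [hpos]
    linarith
  obtain ⟨t, ht, htc⟩ := Set.exists_subset_card_eq hle
  have hte : (fromEdgeSet t).edgeSet = t := by
    rw [edgeSet_fromEdgeSet, sdiff_eq_left, Set.disjoint_left]
    exact fun e he => (G.induce S).not_isDiag_of_mem_edgeSet (ht he)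
  have hH : fromEdgeSet t ≤ G.induce S := by rwa [← edgeSet_subset_edgeSet, hte]
  refine IsTreeConn.mono (IsSparse.isTreeConn (fun R hR => ?_) ?_) hH
  · rcases eq_or_ne R Set.univ with rfl | hRne
    · rw [eIn_univ, hte, htc, Set.ncard_univ, Nat.card_coe_set_eq]
      push_cast [hpos]
      linarith
    · have hss : Subtype.val '' R ⊂ S := by
        refine (Set.ssubset_iff_subset_ne).2 ⟨Subtype.coe_image_subset _ _, fun h => hRne ?_⟩
        exact Set.eq_univ_of_forall fun x => by
          obtain ⟨y, hy, hxy⟩ := h.symm.subset x.2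
          rwa [← Subtype.ext hxy]
      have h1 := hS.not_prop_of_lt hss
      simp only [not_and, not_lt] at h1
      have h2 := h1 (hR.image _)
      rw [← eIn_induce, Set.ncard_image_of_injective _ Subtype.val_injective] at h2
      exact le_trans (by exact_mod_cast eIn_mono hH le_rfl) h2
  · rw [hte, htc, Nat.card_coe_set_eq]
    push_cast [hpos]
    exact le_rfl

end

theorem stmt8 {V : Type*} [Fintype V] (m : ℕ) (hm : 0 < m) (G : SimpleGraph V) :
    IsSparse m G ↔ ∀ v : V, IsSparse m (G.induce (mComp m G v)) := by
  refine ⟨fun h v => h.induce _, fun h => ?_⟩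
  by_contra hG
  unfold IsSparse at hG
  push Not at hG
  obtain ⟨S, hS⟩ := exists_minimal_of_wellFoundedLT
    (fun S : Set V => S.Nonempty ∧ (m : ℤ) * S.ncard - m < eIn G S) hG
  obtain ⟨⟨v, hv⟩, hlt⟩ := hS.prop
  have hsub : S ⊆ mComp m G v :=
    Set.subset_sUnion_of_mem ⟨hv, isTreeConn_induce_of_minimal hS⟩
  have h1 := h v (Subtype.val ⁻¹' S) ⟨⟨v, hsub hv⟩, hv⟩
  rw [eIn_induce, ← Set.ncard_image_of_injective _ Subtype.val_injective,
    Subtype.image_preimage_coe, Set.inter_eq_self_of_subset_right hsub] at h1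
  exact h1.not_gt hlt
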